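/- Fix 0 < p < 1. The sequence a_n = n^{1−1/p} · Γ(1+n/p)^{1/n} / ((n!)^{1/n} · Γ(1+1/p)), defined for integers n ≥ 1, is non-increasing in n, and lim_{n→∞} a_n = e^{1−1/p} / (Γ(1+1/p) · p^{1/p}), where Γ denotes the Euler Gamma function. -/

import Mathlib

/-- The sequence `aₙ = n^(1−1/p) · Γ(1+n/p)^(1/n) / ((n!)^(1/n) · Γ(1+1/p))`. -/
noncomputable def a (p : ℝ) (n : ℕ) : ℝ :=
  (n : ℝ) ^ (1 - 1 / p) * Real.Gamma (1 + (n : ℝ) / p) ^ (1 / (n : ℝ)) /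
    (((Nat.factorial n : ℕ) : ℝ) ^ (1 / (n : ℝ)) * Real.Gamma (1 + 1 / p))

open Real Filter Topology Set in
/-- If `f` has second derivative `f₂` with `x * f₂ x ≤ 1`, then
`(f (s * x) - f x) / x - (s - 1) * log x` is antitone on `(0, ∞)`. -/
theorem antitoneOn_dilation_sub_div {f f₁ f₂ : ℝ → ℝ} {s : ℝ} (hs : 1 ≤ s)
    (hf : ∀ x, 0 < x → HasDerivAt f (f₁ x) x) (hf₁ : ∀ x, 0 < x → HasDerivAt f₁ (f₂ x) x)
    (hf₂ : ∀ x, 0 < x → x * f₂ x ≤ 1) :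
    AntitoneOn (fun x => (f (s * x) - f x) / x - (s - 1) * log x) (Ioi 0) := by
  have hs0 : 0 < s := by linarith
  have h_deriv : ∀ x, 0 < x → HasDerivAt (fun y => y * f₁ y - f y - y) (x * f₂ x - 1) x := by
    intro x hx
    refine ((((hasDerivAt_id x).mul (hf₁ x hx)).sub (hf x hx)).sub (hasDerivAt_id x)).congr_deriv ?_
    simp
  have h_anti : AntitoneOn (fun y => y * f₁ y - f y - y) (Ioi 0) := by
    refine antitoneOn_of_deriv_nonpos (convex_Ioi 0)
      (fun x hx => (h_deriv x hx).continuousAt.continuousWithinAt) ?_ ?_ <;>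
      rw [interior_Ioi]
    · exact fun x hx => (h_deriv x hx).differentiableAt.differentiableWithinAt
    · intro x hx
      rw [(h_deriv x hx).deriv]
      linarith [hf₂ x hx]
  have g_deriv : ∀ x, 0 < x →
      HasDerivAt (fun x => (f (s * x) - f x) / x - (s - 1) * log x)
        (((s * x * f₁ (s * x) - f (s * x) - s * x) - (x * f₁ x - f x - x)) / x ^ 2) x := by
    intro x hx
    have h₁ : HasDerivAt (fun x => f (s * x)) (f₁ (s * x) * (s * 1)) x :=
      (hf (s * x) (by positivity)).comp x ((hasDerivAt_id x).const_mul s)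
    refine (((h₁.sub (hf x hx)).div (hasDerivAt_id x) hx.ne').sub
      ((hasDerivAt_log hx.ne').const_mul (s - 1))).congr_deriv ?_
    simp only [id, Pi.sub_apply]
    field_simp
    ring
  refine antitoneOn_of_deriv_nonpos (convex_Ioi 0)
    (fun x hx => (g_deriv x hx).continuousAt.continuousWithinAt) ?_ ?_ <;>
    rw [interior_Ioi]
  · exact fun x hx => (g_deriv x hx).differentiableAt.differentiableWithinAt
  · intro x hx
    have hx0 : 0 < x := hx
    rw [(g_deriv x hx).deriv]
    refine div_nonpos_of_nonpos_of_nonneg ?_ (by positivity)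
    exact sub_nonpos.2 (h_anti hx (mem_Ioi.2 (by positivity)) (le_mul_of_one_le_left hx0.le hs))

theorem sum_range_inv_sq_le {x : ℝ} (hx : 0 < x) (N : ℕ) :
    ∑ m ∈ Finset.range N, 1 / (x + 1 + m) ^ 2 ≤ 1 / x - 1 / (x + N) := by
  induction N with
  | zero => simp
  | succ N ih =>
    rw [Finset.sum_range_succ]
    have key : 1 / (x + 1 + N) ^ 2 ≤ 1 / (x + N) - 1 / (x + (N + 1 : ℕ)) := by
      have h : (0 : ℝ) < x + N := by positivity
      push_cast
      rw [div_sub_div _ _ h.ne' (by positivity), div_le_div_iff₀ (by positivity) (by positivity)]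
      nlinarith
    linarith

open Real Filter Topology Set in
theorem antitoneOn_logGammaSeq_dilation {s : ℝ} (hs : 1 ≤ s) (N : ℕ) :
    AntitoneOn (fun x => (BohrMollerup.logGammaSeq (1 + s * x) N -
      BohrMollerup.logGammaSeq (1 + x) N) / x - (s - 1) * log x) (Ioi 0) := by
  refine antitoneOn_dilation_sub_div (f := fun x => BohrMollerup.logGammaSeq (1 + x) N)
    (f₁ := fun x => log N - ∑ m ∈ Finset.range (N + 1), 1 / (x + 1 + m))
    (f₂ := fun x => ∑ m ∈ Finset.range (N + 1), 1 / (x + 1 + m) ^ 2) hs ?_ ?_ ?_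
  · intro x hx
    have h : ∀ m ∈ Finset.range (N + 1),
        HasDerivAt (fun x : ℝ => log (1 + x + m)) (1 / (x + 1 + m)) x := by
      intro m _
      have h₁ : HasDerivAt (fun x : ℝ => 1 + x + m) 1 x :=
        ((hasDerivAt_id x).const_add 1).add_const (m : ℝ)
      convert h₁.log (by positivity) using 2
      ring
    unfold BohrMollerup.logGammaSeq
    refine ((((((hasDerivAt_id x).const_add 1).mul_const (log N)).add_const
      (log (N.factorial : ℝ)))).sub (HasDerivAt.fun_sum h)).congr_deriv ?_
    simp
  · intro x hx
    have h : ∀ m ∈ Finset.range (N + 1),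
        HasDerivAt (fun x : ℝ => 1 / (x + 1 + m)) (-(1 / (x + 1 + m) ^ 2)) x := by
      intro m _
      have h₁ : HasDerivAt (fun x : ℝ => x + 1 + m) 1 x :=
        ((hasDerivAt_id x).add_const 1).add_const (m : ℝ)
      simp only [one_div]
      refine (h₁.fun_inv (by positivity)).congr_deriv ?_
      ring
    refine ((HasDerivAt.fun_sum h).const_sub (log N)).congr_deriv ?_
    simp
  · intro x hx
    have h := sum_range_inv_sq_le hx (N + 1)
    have h₀ : 0 ≤ 1 / (x + (N + 1 : ℕ)) := by positivity
    calc x * _ ≤ x * (1 / x) := mul_le_mul_of_nonneg_left (by linarith) hx.le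
      _ = 1 := by field_simp

open Real Filter Topology Set in
theorem antitoneOn_log_Gamma_dilation {s : ℝ} (hs : 1 ≤ s) :
    AntitoneOn (fun x => (log (Gamma (1 + s * x)) - log (Gamma (1 + x))) / x - (s - 1) * log x)
      (Ioi 0) := by
  have key : ∀ x : ℝ, 0 < x → Tendsto (fun N => (BohrMollerup.logGammaSeq (1 + s * x) N -
      BohrMollerup.logGammaSeq (1 + x) N) / x - (s - 1) * log x) atTop
      (𝓝 ((log (Gamma (1 + s * x)) - log (Gamma (1 + x))) / x - (s - 1) * log x)) := by
    intro x hx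
    have hsx : 0 < 1 + s * x := by
      have : 0 < s := by linarith
      positivity
    exact (((BohrMollerup.tendsto_log_gamma hsx).sub
      (BohrMollerup.tendsto_log_gamma (by positivity))).div_const x).sub_const _
  intro x hx y hy hxy
  exact le_of_tendsto_of_tendsto' (key y hy) (key x hx)
    fun N => antitoneOn_logGammaSeq_dilation hs N hx hy hxy

open Real in
theorem log_factorial_succ_le (n : ℕ) :
    log ((n + 1).factorial : ℝ) ≤ (n + 2) * log (n + 1) - n := by
  induction n with
  | zero => simp
  | succ n ih =>
    have h : 1 - ((n + 2 : ℝ) / (n + 1))⁻¹ ≤ log ((n + 2) / (n + 1)) :=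
      one_sub_inv_le_log_of_pos (by positivity)
    rw [log_div (by positivity) (by positivity)] at h
    have h₁ : 1 - ((n + 2 : ℝ) / (n + 1))⁻¹ = 1 / (n + 2) := by field_simp; ring
    rw [h₁, div_le_iff₀ (by positivity)] at h
    rw [Nat.factorial_succ, Nat.cast_mul, log_mul (by positivity) (by positivity)]
    push_cast
    rw [show (n : ℝ) + 1 + 1 = n + 2 by ring]
    linarith

open Real in
theorem le_log_Gamma_one_add {x : ℝ} (hx : 2 ≤ x) :
    x * log x - x - log x ≤ log (Gamma (1 + x)) := by
  have hn : 1 ≤ ⌊x⌋₊ := Nat.le_floor (by norm_num; linarith)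
  have hn' : (1 : ℝ) ≤ ⌊x⌋₊ := by exact_mod_cast hn
  have hle : (⌊x⌋₊ : ℝ) ≤ x := Nat.floor_le (by linarith)
  have hlt : x < ⌊x⌋₊ + 1 := Nat.lt_floor_add_one x
  set n := ⌊x⌋₊
  have hst := Stirling.le_log_factorial_stirling (show n ≠ 0 by omega)
  have hmono : log (n.factorial : ℝ) ≤ log (Gamma (1 + x)) := by
    rw [← Gamma_nat_eq_factorial]
    refine log_le_log (Gamma_pos_of_pos (by positivity)) ?_
    exact Gamma_strictMonoOn_Ici.monotoneOn (Set.mem_Ici.2 (by linarith))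
      (Set.mem_Ici.2 (by linarith)) (by linarith)
  have hlogn : 0 ≤ log (n : ℝ) := log_nonneg hn'
  have hpi : 0 ≤ log (2 * π) := log_nonneg (by linarith [pi_gt_three])
  have hlogx : 0 ≤ log x := log_nonneg (by linarith)
  have h := one_sub_inv_le_log_of_pos (show 0 < (n : ℝ) / x by positivity)
  rw [log_div (by positivity) (by positivity), inv_div] at h
  have h₂ : n * (1 - x / n) = n - x := by field_simp
  have h₃ := mul_le_mul_of_nonneg_left h (show (0 : ℝ) ≤ n by positivity)
  nlinarith

open Real in
theorem log_Gamma_one_add_le {x : ℝ} (hx : 2 ≤ x) :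
    log (Gamma (1 + x)) ≤ x * log x - x + 2 * log x + 2 * log 2 + 1 := by
  have hle : (⌊x⌋₊ : ℝ) ≤ x := Nat.floor_le (by linarith)
  have hlt : x < ⌊x⌋₊ + 1 := Nat.lt_floor_add_one x
  set n := ⌊x⌋₊
  have hx0 : 0 < x := by linarith
  have hmono : log (Gamma (1 + x)) ≤ log ((n + 1).factorial : ℝ) := by
    rw [← Gamma_nat_eq_factorial]
    refine log_le_log (Gamma_pos_of_pos (by positivity)) ?_
    push_cast
    exact Gamma_strictMonoOn_Ici.monotoneOn (Set.mem_Ici.2 (by linarith))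
      (Set.mem_Ici.2 (by linarith)) (by linarith)
  have hfac := log_factorial_succ_le n
  have hlog : log (n + 1) ≤ log x + log 2 := by
    rw [← log_mul hx0.ne' (by norm_num)]
    exact log_le_log (by positivity) (by linarith)
  have h := one_sub_inv_le_log_of_pos (show 0 < x / (n + 1 : ℝ) by positivity)
  rw [log_div (by positivity) (by positivity), inv_div] at h
  have h₂ : x * (1 - (n + 1) / x) = x - (n + 1) := by field_simp
  have h₃ := mul_le_mul_of_nonneg_left h hx0.le
  have hlogn : 0 ≤ log (n + 1 : ℝ) := log_nonneg (by linarith)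
  nlinarith

open Real Filter Topology in
theorem tendsto_log_Gamma_one_add_div_sub_log :
    Tendsto (fun x => log (Gamma (1 + x)) / x - log x) atTop (𝓝 (-1)) := by
  have hlog : Tendsto (fun x : ℝ => log x / x) atTop (𝓝 0) :=
    isLittleO_log_id_atTop.tendsto_div_nhds_zero
  have hlow : Tendsto (fun x : ℝ => -1 - log x / x) atTop (𝓝 (-1)) := by
    simpa using hlog.const_sub (-1)
  have hupp : Tendsto (fun x : ℝ => -1 + 2 * (log x / x) + (2 * log 2 + 1) / x) atTop
      (𝓝 (-1)) := by
    simpa using ((hlog.const_mul 2).const_add (-1)).add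
      (tendsto_const_nhds.div_atTop tendsto_id (a := 2 * log 2 + 1))
  refine tendsto_of_tendsto_of_tendsto_of_le_of_le' hlow hupp ?_ ?_ <;>
    filter_upwards [eventually_ge_atTop 2] with x hx
  · have hx0 : 0 < x := by linarith
    calc -1 - log x / x = (x * log x - x - log x) / x - log x := by field_simp; ring
      _ ≤ _ := by gcongr; exact le_log_Gamma_one_add hx
  · have hx0 : 0 < x := by linarith
    calc _ ≤ (x * log x - x + 2 * log x + 2 * log 2 + 1) / x - log x := by
          gcongr; exact log_Gamma_one_add_le hx
      _ = _ := by field_simp; ring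

open Real in
theorem a_eq_exp {p : ℝ} (hp : 0 < p) {n : ℕ} (hn : 1 ≤ n) :
    a p n = exp ((log (Gamma (1 + 1 / p * n)) - log (Gamma (1 + n))) / n
      - (1 / p - 1) * log n) / Gamma (1 + 1 / p) := by
  have hn0 : (0 : ℝ) < n := by exact_mod_cast hn
  have hΓ : 0 < Gamma (1 + 1 / p * n) := Gamma_pos_of_pos (by positivity)
  have hfac : ((n.factorial : ℕ) : ℝ) = Gamma (1 + n) := by
    rw [add_comm, Gamma_nat_eq_factorial]
  have hΓn : 0 < Gamma (1 + (n : ℝ)) := Gamma_pos_of_pos (by positivity)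
  rw [a, hfac, show (n : ℝ) / p = 1 / p * n by ring, rpow_def_of_pos hn0, rpow_def_of_pos hΓ,
    rpow_def_of_pos hΓn, ← div_div, ← exp_add, ← exp_sub]
  congr 2
  ring

/-- For `0 < p < 1`, the sequence `aₙ` is non-increasing for `n ≥ 1`, and it converges
to `e^(1−1/p) / (Γ(1+1/p) · p^(1/p))`. -/
theorem a_antitone_and_tendsto (p : ℝ) (hp1 : 0 < p) (hp2 : p < 1) :
    (∀ n m : ℕ, 1 ≤ n → n ≤ m → a p m ≤ a p n) ∧
      Filter.Tendsto (a p) Filter.atTop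
        (nhds (Real.exp (1 - 1 / p) / (Real.Gamma (1 + 1 / p) * p ^ (1 / p)))) := by
  have hs : 1 ≤ 1 / p := (one_le_div hp1).2 hp2.le
  have hΓ : 0 < Real.Gamma (1 + 1 / p) := Real.Gamma_pos_of_pos (by positivity)
  constructor
  · intro n m hn hnm
    have hn0 : (0 : ℝ) < n := by exact_mod_cast hn
    have hnm' : (n : ℝ) ≤ m := by exact_mod_cast hnm
    rw [a_eq_exp hp1 hn, a_eq_exp hp1 (hn.trans hnm)]
    refine div_le_div_of_nonneg_right (Real.exp_le_exp.2 ?_) hΓ.le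
    exact antitoneOn_log_Gamma_dilation hs hn0 (hn0.trans_le hnm') hnm'
  · have hF := tendsto_log_Gamma_one_add_div_sub_log
    have h₁ := hF.comp (tendsto_natCast_atTop_atTop (R := ℝ))
    have h₂ := hF.comp ((tendsto_natCast_atTop_atTop (R := ℝ)).const_mul_atTop
      (show 0 < 1 / p by positivity))
    have h₃ := (((h₂.const_mul (1 / p)).sub h₁).add_const (1 / p * Real.log (1 / p))).rexp.div_const
      (Real.Gamma (1 + 1 / p))
    have hlim : Real.exp (1 / p * -1 - -1 + 1 / p * Real.log (1 / p)) / Real.Gamma (1 + 1 / p) =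
        Real.exp (1 - 1 / p) / (Real.Gamma (1 + 1 / p) * p ^ (1 / p)) := by
      rw [Real.rpow_def_of_pos hp1, mul_comm (Real.Gamma _), ← div_div, ← Real.exp_sub, one_div p,
        Real.log_inv]
      congr 2
      ring
    rw [← hlim]
    refine h₃.congr' ?_
    filter_upwards [Filter.eventually_ge_atTop 1] with n hn
    have hn0 : (0 : ℝ) < n := by exact_mod_cast hn
    rw [a_eq_exp hp1 hn]
    congr 2
    simp only [Function.comp]
    rw [Real.log_mul (by positivity) hn0.ne']
    field_simp
    ring
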